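/- arXiv:2009.09101 — 2 statements merged into one kernel-verified Lean document; each statement's English description precedes it below -/
import Mathlib

section
/- Fix σ² > 0 and positive-real sequences m = (m_c)_{c∈ℕ} and l = (l_c)_{c∈ℕ}, and let (𝒳,d) be a separable complete metric space with a jointly Borel measurable geodesic CAT(0) structure. Consider the i.i.d. hierarchical model: θ₁,…,θₙ are i.i.d. with law Q̃ ∈ 𝒫_l⁽¹⁾, and given θ = (θ₁,…,θₙ), the X₁,…,Xₙ are conditionally independent with Xᵢ | θᵢ ∼ P̃_{θᵢ}, where for every θ ∈ 𝒳 the law P̃_θ belongs to 𝒫_m⁽¹⁾, has Fréchet mean θ and Fréchet variance σ², and θ ↦ P̃_θ is a Markov kernel. Let ω be a Fréchet mean of the marginal law of X₁, and let X̄⁽ⁿ⁾ : 𝒳ⁿ → 𝒳 be a Borel measurable sample Fréchet mean, i.e. X̄⁽ⁿ⁾(x) minimizes z ↦ ∑ᵢ d(z,xᵢ)² over 𝒳. Assume there is a constant C, depending only on m and l, such that E[d(X̄⁽ⁿ⁾(X),ω)²] ≤ C/n for all n and all such models. Then there exists n*, depending only on σ², m and l, such that for all n ≥ n*, the adaptive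 geodesic James–Stein estimator with data-dependent shrinkage point ψ = (X̄⁽ⁿ⁾(X),…,X̄⁽ⁿ⁾(X)) satisfies E[d(θ,δ_JS(X))²] < E[d(θ,X)²] = σ², for every choice of Q̃ ∈ 𝒫_l⁽¹⁾ and every kernel (P̃_θ) as above. -/
open MeasureTheory ProbabilityTheory Filter

/-- A geodesic CAT(0) structure on a metric space `X`: a geodesic selection
`γ x y t` (`t ∈ [0,1]`) with endpoints `x`, `y`, affinely parameterized,
satisfying the CAT(0) comparison inequality. -/
structure GeodesicCAT0 (X : Type*) [MetricSpace X] where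
  γ : X → X → ℝ → X
  γ_zero : ∀ x y : X, γ x y 0 = x
  γ_one : ∀ x y : X, γ x y 1 = y
  dist_γ : ∀ x y : X, ∀ s ∈ Set.Icc (0:ℝ) 1, ∀ t ∈ Set.Icc (0:ℝ) 1,
    dist (γ x y s) (γ x y t) = |s - t| * dist x y
  cat0 : ∀ x y z : X, ∀ t ∈ Set.Icc (0:ℝ) 1,
    dist (γ x y t) z ^ 2 ≤
      (1 - t) * dist x z ^ 2 + t * dist y z ^ 2 - t * (1 - t) * dist x y ^ 2

/-- Joint Borel measurability of the geodesic map of a `GeodesicCAT0` structure. -/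
def GeodesicCAT0.MeasurableGeo {X : Type*} [MetricSpace X] [MeasurableSpace X]
    (G : GeodesicCAT0 X) : Prop :=
  Measurable fun p : X × X × ℝ => G.γ p.1 p.2.1 p.2.2

/-- `θ` is a Fréchet mean of the Borel random object `f` (defined on a probability
space `(Ω, P)`, taking values in a metric space): it minimizes `z ↦ E[d(z, f)²]`. -/
def IsFrechetMeanRV {Ω X : Type*} [MetricSpace X] [MeasurableSpace Ω]
    (P : Measure Ω) (f : Ω → X) (θ : X) : Prop :=
  ∀ z : X, ∫ ω, dist θ (f ω) ^ 2 ∂P ≤ ∫ ω, dist z (f ω) ^ 2 ∂P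

/-- `θ` is a Fréchet mean of the Borel probability measure `P` on a metric space:
it minimizes `z ↦ ∫ d(z,u)² dP(u)`. -/
def IsFrechetMean {X : Type*} [MetricSpace X] [MeasurableSpace X]
    (P : Measure X) (θ : X) : Prop :=
  ∀ z : X, ∫ u, dist θ u ^ 2 ∂P ≤ ∫ u, dist z u ^ 2 ∂P

/-- The James–Stein shrinkage weight `w = min(1, σ²/dsq)` as a function of the squared
distance `dsq` to the shrinkage point, with `w = 1` when `dsq = 0`. -/
noncomputable def jsWeight (σsq dsq : ℝ) : ℝ :=
  if dsq = 0 then 1 else min 1 (σsq / dsq)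

open scoped ProbabilityTheory

/-- An i.i.d. hierarchical model on a metric space `𝒳`: a prior `Q̃ ∈ 𝒫_l⁽¹⁾` with
Fréchet mean `μ̃`, and a Markov kernel `θ ↦ P̃_θ ∈ 𝒫_m⁽¹⁾` with Fréchet mean `θ` and
Fréchet variance `σ²`, together with, for each `n`, the Markov kernel on the product
space given by the conditional product law `θ ↦ P̃_{θ₁} × ⋯ × P̃_{θₙ}`. -/
structure IIDHierModel (𝒳 : Type*) [MetricSpace 𝒳] [MeasurableSpace 𝒳]
    (σsq : ℝ) (m l : ℕ → ℝ) where
  Qt : Measure 𝒳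
  prob : IsProbabilityMeasure Qt
  μt : 𝒳
  prior_mean : IsFrechetMean Qt μt
  prior_int : ∀ c, 1 ≤ c → Integrable (fun u => dist u μt ^ c) Qt
  prior_pos : ∀ c, 1 ≤ c → 0 < ∫ u, dist u μt ^ c ∂Qt
  prior_bdd : ∀ c, 1 ≤ c → ∫ u, dist u μt ^ c ∂Qt ≤ l c
  κ : ProbabilityTheory.Kernel 𝒳 𝒳
  markov : ProbabilityTheory.IsMarkovKernel κ
  cond_mean : ∀ θ : 𝒳, IsFrechetMean (κ θ) θ
  cond_int : ∀ θ : 𝒳, ∀ c, 1 ≤ c → Integrable (fun u => dist u θ ^ c) (κ θ)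
  cond_pos : ∀ θ : 𝒳, ∀ c, 1 ≤ c → 0 < ∫ u, dist u θ ^ c ∂(κ θ)
  cond_bdd : ∀ θ : 𝒳, ∀ c, 1 ≤ c → ∫ u, dist u θ ^ c ∂(κ θ) ≤ m c
  cond_var : ∀ θ : 𝒳, ∫ u, dist u θ ^ 2 ∂(κ θ) = σsq
  κn : ∀ n : ℕ, ProbabilityTheory.Kernel (Fin n → 𝒳) (Fin n → 𝒳)
  κn_markov : ∀ n, ProbabilityTheory.IsMarkovKernel (κn n)
  κn_pi : ∀ (n : ℕ) (θ : Fin n → 𝒳), κn n θ = Measure.pi (fun i => κ (θ i))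

/-- The joint law of `(θ⁽ⁿ⁾, X⁽ⁿ⁾)` in the i.i.d. hierarchical model: `θᵢ` i.i.d. from
the prior, and `X | θ` from the conditional product law. -/
noncomputable def IIDHierModel.joint {𝒳 : Type*} [MetricSpace 𝒳] [MeasurableSpace 𝒳]
    {σsq : ℝ} {m l : ℕ → ℝ} (M : IIDHierModel 𝒳 σsq m l) (n : ℕ) :
    Measure ((Fin n → 𝒳) × (Fin n → 𝒳)) :=
  (Measure.pi (fun _ : Fin n => M.Qt)) ⊗ₘ M.κn n

theorem IIDHierModel.measurePreserving_joint {𝒳 : Type*} [MetricSpace 𝒳] [MeasurableSpace 𝒳]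
    {σsq : ℝ} {m l : ℕ → ℝ} (M : IIDHierModel 𝒳 σsq m l) (n : ℕ) :
    MeasurePreserving (fun (p : (Fin n → 𝒳) × (Fin n → 𝒳)) i => (p.1 i, p.2 i))
      (M.joint n) (Measure.pi fun _ => M.Qt ⊗ₘ M.κ) := by
  have := M.prob
  have := M.markov
  have := M.κn_markov n
  have hmeas : Measurable (fun (p : (Fin n → 𝒳) × (Fin n → 𝒳)) i => (p.1 i, p.2 i)) := by
    fun_prop
  refine ⟨hmeas, ?_⟩
  refine (Measure.pi_eq fun s hs => ?_).symm
  rw [Measure.map_apply hmeas (.univ_pi hs), IIDHierModel.joint,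
    Measure.compProd_apply (hmeas (.univ_pi hs))]
  have hsec : ∀ θ : Fin n → 𝒳, M.κn n θ (Prod.mk θ ⁻¹'
      ((fun (p : (Fin n → 𝒳) × (Fin n → 𝒳)) i => (p.1 i, p.2 i)) ⁻¹' Set.univ.pi s))
      = ∏ i, M.κ (θ i) (Prod.mk (θ i) ⁻¹' s i) := by
    intro θ
    rw [M.κn_pi, ← Measure.pi_pi]
    congr 1
  simp_rw [hsec]
  have hf : ∀ i, Measurable fun t : 𝒳 => M.κ t (Prod.mk t ⁻¹' s i) := fun i =>
    Kernel.measurable_kernel_prodMk_left (hs i)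
  have hind : iIndepFun (fun (i : Fin n) (θ : Fin n → 𝒳) => M.κ (θ i) (Prod.mk (θ i) ⁻¹' s i))
      (Measure.pi fun _ : Fin n => M.Qt) :=
    iIndepFun_pi (X := fun i t => M.κ t (Prod.mk t ⁻¹' s i)) fun i => (hf i).aemeasurable
  rw [lintegral_prod_eq_prod_lintegral_of_indepFun Finset.univ _ hind
    fun i => (hf i).comp (measurable_pi_apply i)]
  refine Finset.prod_congr rfl fun i _ => ?_
  rw [Measure.compProd_apply (hs i)]
  exact (measurePreserving_eval (fun _ : Fin n => M.Qt) i).lintegral_comp (hf i)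

/-- The empirical average of `h` over `n` points. -/
noncomputable def empAvg {Z : Type*} (n : ℕ) (h : Z → ℝ) (z : Fin n → Z) : ℝ :=
  (1 / (n : ℝ)) * ∑ i, h (z i)

section EmpiricalAverage

variable {Z : Type*} [MeasurableSpace Z] {ν : Measure Z} [IsProbabilityMeasure ν] {h : Z → ℝ}
  {n : ℕ}

theorem memLp_empAvg (hh : MemLp h 2 ν) :
    MemLp (empAvg n h) 2 (Measure.pi fun _ : Fin n => ν) := by
  have hi : ∀ i : Fin n, MemLp (fun z : Fin n → Z => h (z i)) 2 (Measure.pi fun _ : Fin n => ν) :=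
    fun i => hh.comp_measurePreserving (measurePreserving_eval (fun _ : Fin n => ν) i)
  exact (memLp_finsetSum _ fun i _ => hi i).const_mul _

theorem integral_empAvg (hn : 1 ≤ n) (hh : Integrable h ν) :
    ∫ z, empAvg n h z ∂(Measure.pi fun _ : Fin n => ν) = ∫ z, h z ∂ν := by
  have hn' : (n : ℝ) ≠ 0 := by positivity
  have hmp := fun i => measurePreserving_eval (fun _ : Fin n => ν) i
  have hi : ∀ i, ∫ z : Fin n → Z, h (z i) ∂(Measure.pi fun _ : Fin n => ν) = ∫ z, h z ∂ν := by
    intro i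
    conv_rhs => rw [← (hmp i).map_eq]
    rw [integral_map (hmp i).aemeasurable]
    rw [(hmp i).map_eq]; exact hh.aestronglyMeasurable
  have hint : ∀ i : Fin n, Integrable (fun z : Fin n → Z => h (z i))
      (Measure.pi fun _ : Fin n => ν) := fun i => (hmp i).integrable_comp_of_integrable hh
  simp only [empAvg]
  rw [integral_const_mul, integral_finsetSum _ fun i _ => hint i]
  simp only [hi, Finset.sum_const, Finset.card_univ, Fintype.card_fin, nsmul_eq_mul]
  field_simp

theorem integral_sq_empAvg_sub_le (hn : 1 ≤ n) (hh : MemLp h 2 ν) :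
    ∫ z, (empAvg n h z - ∫ y, h y ∂ν) ^ 2 ∂(Measure.pi fun _ : Fin n => ν)
      ≤ (∫ y, h y ^ 2 ∂ν) / n := by
  have hn' : (0 : ℝ) < n := by positivity
  have hv := variance_eq_integral (memLp_empAvg (n := n) hh).aestronglyMeasurable.aemeasurable
  rw [integral_empAvg hn (hh.integrable (by norm_num))] at hv
  rw [← hv]
  have hs := variance_sum_pi (ι := Fin n) (μ := fun _ => ν) (X := fun _ => h) fun _ => hh
  have he : empAvg n h = fun z => (1 / (n : ℝ)) * (∑ i : Fin n, fun z : Fin n → Z => h (z i)) z := by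
    ext z; simp [empAvg]
  rw [he, variance_const_mul, hs]
  have := variance_le_expectation_sq (μ := ν) hh.aestronglyMeasurable
  simp only [Finset.sum_const, Finset.card_univ, Fintype.card_fin, nsmul_eq_mul]
  calc (1 / (n : ℝ)) ^ 2 * (n * Var[h; ν]) = Var[h; ν] / n := by field_simp
    _ ≤ _ := by gcongr; exact this

end EmpiricalAverage

theorem GeodesicCAT0.integral_dist_sq_le {X : Type*} [MetricSpace X] [MeasurableSpace X]
    (G : GeodesicCAT0 X) {P : Measure X} [IsProbabilityMeasure P]
    (hint : ∀ z, Integrable (fun u => dist z u ^ 2) P) (x y : X) {t : ℝ}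
    (ht : t ∈ Set.Icc (0 : ℝ) 1) :
    ∫ u, dist (G.γ x y t) u ^ 2 ∂P ≤ (1 - t) * ∫ u, dist x u ^ 2 ∂P + t * ∫ u, dist y u ^ 2 ∂P
      - t * (1 - t) * dist x y ^ 2 := by
  have hx : Integrable (fun u => (1 - t) * dist x u ^ 2) P := (hint x).const_mul _
  have hy : Integrable (fun u => t * dist y u ^ 2) P := (hint y).const_mul _
  have hxy : Integrable (fun u => (1 - t) * dist x u ^ 2 + t * dist y u ^ 2) P := hx.add hy
  have h : ∫ u, dist (G.γ x y t) u ^ 2 ∂P ≤ ∫ u, ((1 - t) * dist x u ^ 2 + t * dist y u ^ 2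
      - t * (1 - t) * dist x y ^ 2) ∂P :=
    integral_mono (hint _) (hxy.sub (integrable_const _)) fun u => G.cat0 x y u t ht
  rwa [integral_sub hxy (integrable_const _), integral_add hx hy, integral_const_mul,
    integral_const_mul, integral_const, probReal_univ, one_smul] at h

theorem dist_sq_add_integral_le {X : Type*} [MetricSpace X] [MeasurableSpace X]
    (G : GeodesicCAT0 X) {P : Measure X} [IsProbabilityMeasure P] {θ : X}
    (hθ : IsFrechetMean P θ) (hint : ∀ z, Integrable (fun u => dist z u ^ 2) P) (z : X) :
    dist θ z ^ 2 + ∫ u, dist θ u ^ 2 ∂P ≤ ∫ u, dist z u ^ 2 ∂P := by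
  have key : ∀ t ∈ Set.Ioc (0 : ℝ) 1,
      (1 - t) * dist θ z ^ 2 + ∫ u, dist θ u ^ 2 ∂P ≤ ∫ u, dist z u ^ 2 ∂P := by
    intro t ht
    have h1 := G.integral_dist_sq_le hint θ z ⟨ht.1.le, ht.2⟩
    have h2 := hθ (G.γ θ z t)
    have h3 : t * ((1 - t) * dist θ z ^ 2 + ∫ u, dist θ u ^ 2 ∂P) ≤ t * ∫ u, dist z u ^ 2 ∂P := by
      linarith
    exact le_of_mul_le_mul_left h3 ht.1
  refine le_of_forall_pos_le_add fun ε hε => ?_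
  have hd : 0 ≤ dist θ z ^ 2 := by positivity
  have := key (min 1 (ε / (dist θ z ^ 2 + 1))) ⟨by positivity, min_le_left _ _⟩
  have h4 : min 1 (ε / (dist θ z ^ 2 + 1)) * dist θ z ^ 2 ≤ ε := by
    calc _ ≤ (ε / (dist θ z ^ 2 + 1)) * (dist θ z ^ 2 + 1) := by
          gcongr
          · exact min_le_right _ _
          · linarith
      _ = ε := by field_simp
  linarith

theorem exists_isFrechetMean {X : Type*} [MetricSpace X] [CompleteSpace X] [MeasurableSpace X]
    (G : GeodesicCAT0 X) {P : Measure X} [IsProbabilityMeasure P] [Nonempty X]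
    (hint : ∀ z, Integrable (fun u => dist z u ^ 2) P) :
    ∃ ω, IsFrechetMean P ω := by
  set F : X → ℝ := fun z => ∫ u, dist z u ^ 2 ∂P with hF
  have hF0 : ∀ z, 0 ≤ F z := fun z => integral_nonneg fun u => by positivity
  have hbdd : BddBelow (Set.range F) := ⟨0, by rintro _ ⟨z, rfl⟩; exact hF0 z⟩
  set I := ⨅ z, F z with hI
  have hIle : ∀ z, I ≤ F z := fun z => ciInf_le hbdd z
  have hmid : ∀ x y, dist x y ^ 2 ≤ 2 * (F x - I) + 2 * (F y - I) := by
    intro x y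
    have h1 := G.integral_dist_sq_le hint x y (t := 1 / 2) ⟨by norm_num, by norm_num⟩
    have h2 := hIle (G.γ x y (1 / 2))
    change F _ ≤ (1 - 1 / 2) * F x + 1 / 2 * F y - _ at h1
    linarith
  have hseq : ∀ k : ℕ, ∃ z, F z < I + 1 / ((k : ℝ) + 1) := fun k =>
    exists_lt_of_ciInf_lt (lt_add_of_pos_right _ (by positivity))
  choose z hz using hseq
  have hlim : Tendsto (fun k : ℕ => 1 / ((k : ℝ) + 1)) atTop (nhds 0) :=
    tendsto_one_div_add_atTop_nhds_zero_nat
  have hcauchy : CauchySeq z := by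
    refine cauchySeq_of_le_tendsto_0 (fun k => √(4 * (1 / ((k : ℝ) + 1)))) ?_ ?_
    · intro i j k hi hj
      refine Real.le_sqrt_of_sq_le ?_
      have hi' : 1 / ((i : ℝ) + 1) ≤ 1 / ((k : ℝ) + 1) := by gcongr
      have hj' : 1 / ((j : ℝ) + 1) ≤ 1 / ((k : ℝ) + 1) := by gcongr
      linarith [hmid (z i) (z j), hz i, hz j]
    · have := (hlim.const_mul 4).sqrt
      simpa using this
  obtain ⟨ω, hω⟩ := cauchySeq_tendsto_of_complete hcauchy
  refine ⟨ω, fun y => ?_⟩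
  change F ω ≤ F y
  refine le_trans ?_ (hIle y)
  have hbound : ∀ k, ∀ ε > 0, F ω ≤ (1 + ε) * F (z k) + (1 + 1 / ε) * dist ω (z k) ^ 2 := by
    intro k ε hε
    have h1 : F ω ≤ ∫ u, ((1 + ε) * dist (z k) u ^ 2 + (1 + 1 / ε) * dist ω (z k) ^ 2) ∂P := by
      refine integral_mono (hint _) (((hint _).const_mul _).add (integrable_const _)) fun u => ?_
      have h2 := dist_triangle ω (z k) u
      have h3 : dist ω u ^ 2 ≤ (dist ω (z k) + dist (z k) u) ^ 2 := by gcongr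
      refine h3.trans ?_
      have h4 : (1 + ε) * dist (z k) u ^ 2 + (1 + 1 / ε) * dist ω (z k) ^ 2
          - (dist ω (z k) + dist (z k) u) ^ 2 = (ε * dist (z k) u - dist ω (z k)) ^ 2 / ε := by
        field_simp; ring
      have h5 : 0 ≤ (ε * dist (z k) u - dist ω (z k)) ^ 2 / ε := by positivity
      linarith
    rw [integral_add ((hint _).const_mul _) (integrable_const _), integral_const_mul,
      integral_const] at h1
    simpa using h1
  have hFz : Tendsto (fun k => F (z k)) atTop (nhds I) := by
    refine tendsto_of_tendsto_of_tendsto_of_le_of_le tendsto_const_nhds ?_ (fun k => hIle (z k))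
      fun k => (hz k).le
    simpa using hlim.const_add I
  have hd : Tendsto (fun k => dist ω (z k)) atTop (nhds 0) := by
    simpa [dist_comm] using tendsto_iff_dist_tendsto_zero.1 hω
  have hε : ∀ ε > 0, F ω ≤ (1 + ε) * I := by
    intro ε hε
    have h1 := (hFz.const_mul (1 + ε)).add ((hd.pow 2).const_mul (1 + 1 / ε))
    have h2 := ge_of_tendsto' h1 fun k => hbound k ε hε
    simpa using h2
  have h3 : Tendsto (fun ε : ℝ => (1 + ε) * I) (nhdsWithin 0 (Set.Ioi 0)) (nhds ((1 + 0) * I)) :=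
    ((continuous_const.add continuous_id).mul continuous_const).continuousWithinAt
  have h4 := ge_of_tendsto h3 (eventually_nhdsWithin_of_forall fun ε h => hε ε h)
  simpa using h4

section Weight

variable {σsq D : ℝ}

theorem jsWeight_mem_Icc (hσ : 0 < σsq) (hD : 0 ≤ D) : jsWeight σsq D ∈ Set.Icc (0 : ℝ) 1 := by
  unfold jsWeight
  split_ifs
  · simp
  · exact ⟨by positivity, min_le_left _ _⟩

theorem jsWeight_mul_one_sub_mul (hσ : 0 < σsq) (hD : 0 ≤ D) :
    jsWeight σsq D * (1 - jsWeight σsq D) * D = σsq * (1 - jsWeight σsq D) := by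
  unfold jsWeight
  split_ifs with h
  · simp
  · have hD' : 0 < D := lt_of_le_of_ne hD (Ne.symm h)
    rcases le_total D σsq with hle | hle
    · rw [min_eq_left ((one_le_div hD').2 hle)]; ring
    · rw [min_eq_right ((div_le_one hD').2 hle)]; field_simp

theorem jsWeight_le (hσ : 0 < σsq) (hD : 0 ≤ D) {Δ q : ℝ} (hΔ : σsq ≤ Δ) (hq : 0 ≤ q)
    (hDq : Δ - D ≤ q) : jsWeight σsq D ≤ σsq / Δ + q / σsq := by
  have hΔ0 : 0 < Δ := hσ.trans_le hΔ
  have h1 : D ≤ σsq → 1 ≤ σsq / Δ + q / σsq := by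
    intro h
    have h2 : (Δ - σsq) / Δ ≤ q / σsq := div_le_div₀ hq (by linarith) hσ hΔ
    rw [sub_div, div_self hΔ0.ne'] at h2
    linarith
  unfold jsWeight
  split_ifs with h
  · exact h1 (by rw [h]; exact hσ.le)
  · have hD' : 0 < D := lt_of_le_of_ne hD (Ne.symm h)
    rcases le_total D σsq with hle | hle
    · exact (min_le_left _ _).trans (h1 hle)
    · refine (min_le_right _ _).trans ?_
      have h3 : σsq / D - σsq / Δ = σsq * (Δ - D) / (D * Δ) := by field_simp
      have h4 : σsq * (Δ - D) / (D * Δ) ≤ σsq * q / (σsq * σsq) :=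
        div_le_div₀ (by positivity) (by gcongr) (by positivity) (by gcongr)
      have h5 : σsq * q / (σsq * σsq) = q / σsq := by field_simp
      linarith

end Weight

theorem abs_le_half_mul_sq_add {s : ℝ} (hs : 0 < s) (x : ℝ) : |x| ≤ (s * x ^ 2 + 1 / s) / 2 := by
  have h : s * x ^ 2 + 1 / s - 2 * |x| = (s * |x| - 1) ^ 2 / s := by
    rw [← sq_abs x]; field_simp; ring
  have : 0 ≤ (s * |x| - 1) ^ 2 / s := by positivity
  linarith

theorem add_sq_le_one_add_mul {s : ℝ} (hs : 0 < s) (x y : ℝ) :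
    (x + y) ^ 2 ≤ (1 + s) * x ^ 2 + (y ^ 2 + y ^ 2 / s) := by
  have h : (1 + s) * x ^ 2 + (y ^ 2 + y ^ 2 / s) - (x + y) ^ 2 = (s * x - y) ^ 2 / s := by
    field_simp; ring
  have : 0 ≤ (s * x - y) ^ 2 / s := by positivity
  linarith

/-- Deterministic upper bound for the loss of the James–Stein estimator in terms of the loss `A` of
the naive estimator, the squared distances `B`, `D` to the shrinkage point, their analogues `B₀`,
`D₀` for the population mean, and the squared error `E` of the shrinkage point. -/
theorem jamesStein_loss_le {σsq s Δ β A B D B₀ D₀ E R : ℝ} (hσ : 0 < σsq) (hs : 0 < s)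
    (hΔ : σsq ≤ Δ) (hβ : 0 ≤ β) (hD : 0 ≤ D) (hB₀ : 0 ≤ B₀) (hD₀ : 0 ≤ D₀) (hE : 0 ≤ E)
    (hB : B ≤ (1 + s) * E + (B₀ + B₀ / s)) (hDD : D₀ ≤ (1 + s) * E + (D + D₀ / s))
    (hR : R ≤ (1 - jsWeight σsq D) * A + jsWeight σsq D * B
      - jsWeight σsq D * (1 - jsWeight σsq D) * D) :
    R ≤ A + s / 2 * (A - σsq) ^ 2 + (1 + β / σsq) * (1 + s) * E + 1 / s * B₀
      + s / 2 * (B₀ - β) ^ 2 + β / σsq * (s / 2) * (D₀ - Δ) ^ 2 + β / σsq * (1 / s) * D₀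
      + (-σsq + 1 / s + β * (σsq / Δ) + β / σsq * (1 / (2 * s))) := by
  obtain ⟨hw0, hw1⟩ := jsWeight_mem_Icc hσ hD
  have hq := jsWeight_le (q := (s * (D₀ - Δ) ^ 2 + 1 / s) / 2 + (1 + s) * E + D₀ / s) hσ hD hΔ
    (by positivity) (by
      have := abs_le_half_mul_sq_add hs (D₀ - Δ)
      have := neg_abs_le (D₀ - Δ)
      linarith)
  rw [jsWeight_mul_one_sub_mul hσ hD] at hR
  set w := jsWeight σsq D
  have hA : -(w * (A - σsq)) ≤ (s * (A - σsq) ^ 2 + 1 / s) / 2 := by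
    refine le_trans ?_ (abs_le_half_mul_sq_add hs (A - σsq))
    calc -(w * (A - σsq)) ≤ |w * (A - σsq)| := neg_le_abs _
      _ = w * |A - σsq| := by rw [abs_mul, abs_of_nonneg hw0]
      _ ≤ 1 * |A - σsq| := by gcongr
      _ = _ := one_mul _
  have hwB : w * B ≤ w * B₀ + ((1 + s) * E + B₀ / s) := by
    calc w * B ≤ w * ((1 + s) * E + (B₀ + B₀ / s)) := by gcongr
      _ = w * B₀ + w * ((1 + s) * E + B₀ / s) := by ring
      _ ≤ w * B₀ + 1 * ((1 + s) * E + B₀ / s) := by gcongr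
      _ = _ := by ring
  have hwB₀ : w * (B₀ - β) ≤ (s * (B₀ - β) ^ 2 + 1 / s) / 2 := by
    refine le_trans ?_ (abs_le_half_mul_sq_add hs (B₀ - β))
    calc w * (B₀ - β) ≤ w * |B₀ - β| := by gcongr; exact le_abs_self _
      _ ≤ 1 * |B₀ - β| := by gcongr
      _ = _ := one_mul _
  have hwβ := mul_le_mul_of_nonneg_left hq hβ
  have hfin : A + s / 2 * (A - σsq) ^ 2 + (1 + β / σsq) * (1 + s) * E + 1 / s * B₀
      + s / 2 * (B₀ - β) ^ 2 + β / σsq * (s / 2) * (D₀ - Δ) ^ 2 + β / σsq * (1 / s) * D₀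
      + (-σsq + 1 / s + β * (σsq / Δ) + β / σsq * (1 / (2 * s)))
      = A - σsq + (s * (A - σsq) ^ 2 + 1 / s) / 2 + ((1 + s) * E + B₀ / s)
        + (s * (B₀ - β) ^ 2 + 1 / s) / 2
        + β * (σsq / Δ + ((s * (D₀ - Δ) ^ 2 + 1 / s) / 2 + (1 + s) * E + D₀ / s) / σsq) := by
    field_simp; ring
  rw [hfin]
  linarith

section IntegralBounds

variable {Ω : Type*} [MeasurableSpace Ω] {P : Measure Ω} {f g : Ω → ℝ} {a b : ℝ}

/-- `f` is integrable with integral at most `a`. -/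
def IntegralLE (P : Measure Ω) (f : Ω → ℝ) (a : ℝ) : Prop :=
  Integrable f P ∧ ∫ x, f x ∂P ≤ a

theorem IntegralLE.add (hf : IntegralLE P f a) (hg : IntegralLE P g b) :
    IntegralLE P (fun x => f x + g x) (a + b) := by
  refine ⟨hf.1.add hg.1, ?_⟩
  rw [integral_add hf.1 hg.1]
  exact add_le_add hf.2 hg.2

theorem IntegralLE.const_mul (hf : IntegralLE P f a) {k : ℝ} (hk : 0 ≤ k) :
    IntegralLE P (fun x => k * f x) (k * a) := by
  refine ⟨hf.1.const_mul k, ?_⟩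
  rw [integral_const_mul]
  exact mul_le_mul_of_nonneg_left hf.2 hk

theorem IntegralLE.const [IsProbabilityMeasure P] (k : ℝ) : IntegralLE P (fun _ => k) k :=
  ⟨integrable_const k, by simp⟩

theorem IntegralLE.mono (hg : IntegralLE P g a) (hf : AEStronglyMeasurable f P)
    (hf0 : ∀ x, 0 ≤ f x) (hfg : ∀ x, f x ≤ g x) : IntegralLE P f a := by
  have hint : Integrable f P := hg.1.mono' hf <| ae_of_all _ fun x => by
    rw [Real.norm_of_nonneg (hf0 x)]; exact hfg x
  exact ⟨hint, (integral_mono hint hg.1 hfg).trans hg.2⟩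

theorem IntegralLE.weaken (hf : IntegralLE P f a) (hab : a ≤ b) : IntegralLE P f b :=
  ⟨hf.1, hf.2.trans hab⟩

theorem IntegralLE.comp {Ω' : Type*} [MeasurableSpace Ω'] {P' : Measure Ω'} {T : Ω' → Ω}
    (hf : IntegralLE P f a) (hT : MeasurePreserving T P' P) :
    IntegralLE P' (fun x => f (T x)) a := by
  refine ⟨hT.integrable_comp_of_integrable hf.1, ?_⟩
  rw [← integral_map hT.aemeasurable (by rw [hT.map_eq]; exact hf.1.aestronglyMeasurable),
    hT.map_eq]
  exact hf.2

end IntegralBounds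

namespace IIDHierModel

variable {𝒳 : Type*} [MetricSpace 𝒳] [MeasurableSpace 𝒳] {σsq : ℝ} {m l : ℕ → ℝ}

instance (M : IIDHierModel 𝒳 σsq m l) : IsProbabilityMeasure M.Qt := M.prob

instance (M : IIDHierModel 𝒳 σsq m l) : IsMarkovKernel M.κ := M.markov

instance (M : IIDHierModel 𝒳 σsq m l) (n : ℕ) : IsMarkovKernel (M.κn n) := M.κn_markov n

instance (M : IIDHierModel 𝒳 σsq m l) (n : ℕ) : IsProbabilityMeasure (M.joint n) :=
  inferInstanceAs (IsProbabilityMeasure ((Measure.pi fun _ : Fin n => M.Qt) ⊗ₘ M.κn n))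

theorem measurePreserving_fst (M : IIDHierModel 𝒳 σsq m l) :
    MeasurePreserving Prod.fst (M.Qt ⊗ₘ M.κ) M.Qt :=
  ⟨measurable_fst, Measure.fst_compProd M.Qt M.κ⟩

theorem measurePreserving_snd (M : IIDHierModel 𝒳 σsq m l) :
    MeasurePreserving Prod.snd (M.Qt ⊗ₘ M.κ) (M.Qt.bind fun θ => M.κ θ) :=
  ⟨measurable_snd, Measure.snd_compProd M.Qt M.κ⟩

instance (M : IIDHierModel 𝒳 σsq m l) : IsProbabilityMeasure (M.Qt.bind fun θ => M.κ θ) := by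
  rw [← M.measurePreserving_snd.map_eq]
  exact Measure.isProbabilityMeasure_map measurable_snd.aemeasurable

variable (M : IIDHierModel 𝒳 σsq m l)

theorem empAvg_bounds {n : ℕ} (hn : 1 ≤ n) {h : 𝒳 × 𝒳 → ℝ} (hh : MemLp h 2 (M.Qt ⊗ₘ M.κ)) {a v : ℝ}
    (ha : ∫ q, h q ∂(M.Qt ⊗ₘ M.κ) = a) (hv : ∫ q, h q ^ 2 ∂(M.Qt ⊗ₘ M.κ) ≤ v) :
    IntegralLE (M.joint n) (fun p => (1 / (n : ℝ)) * ∑ i, h (p.1 i, p.2 i)) a ∧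
    IntegralLE (M.joint n) (fun p => ((1 / (n : ℝ)) * ∑ i, h (p.1 i, p.2 i) - a) ^ 2) (v / n) := by
  have hT := M.measurePreserving_joint n
  have hm := memLp_empAvg (n := n) hh
  have hi := hh.integrable (by norm_num)
  refine ⟨IntegralLE.comp (f := empAvg n h) ⟨hm.integrable (by norm_num), ?_⟩ hT,
    IntegralLE.comp (f := fun z => (empAvg n h z - a) ^ 2) ⟨?_, ?_⟩ hT⟩
  · rw [integral_empAvg hn hi, ha]
  · exact (hm.sub (memLp_const a)).integrable_sq
  · subst ha
    refine (integral_sq_empAvg_sub_le hn hh).trans ?_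
    gcongr

theorem memLp_sq_of_integralLE {f : 𝒳 × 𝒳 → ℝ} {a : ℝ} (hf : Measurable f)
    (h4 : IntegralLE (M.Qt ⊗ₘ M.κ) (fun q => f q ^ 4) a) :
    MemLp (fun q => f q ^ 2) 2 (M.Qt ⊗ₘ M.κ) ∧ ∫ q, (f q ^ 2) ^ 2 ∂(M.Qt ⊗ₘ M.κ) ≤ a := by
  simp only [← pow_mul]
  refine ⟨(memLp_two_iff_integrable_sq (hf.pow_const 2).aestronglyMeasurable).2 ?_, h4.2⟩
  simpa only [← pow_mul] using h4.1

variable [BorelSpace 𝒳] [SecondCountableTopology 𝒳]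

theorem integralLE_dist_pow_compProd {c : ℕ} (hc : 1 ≤ c) :
    IntegralLE (M.Qt ⊗ₘ M.κ) (fun q => dist q.1 q.2 ^ c) (m c) := by
  have hmeas : StronglyMeasurable fun q : 𝒳 × 𝒳 => dist q.1 q.2 ^ c := by
    have : Measurable fun q : 𝒳 × 𝒳 => dist q.1 q.2 ^ c := by fun_prop
    exact this.stronglyMeasurable
  have hbd : ∀ θ, ∫ u, dist θ u ^ c ∂(M.κ θ) ≤ m c := fun θ => by
    simpa only [dist_comm] using M.cond_bdd θ c hc
  have h0 : ∀ θ, 0 ≤ ∫ u, dist θ u ^ c ∂(M.κ θ) := fun θ => integral_nonneg fun u => by positivity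
  have hI : Integrable (fun θ => ∫ u, dist θ u ^ c ∂(M.κ θ)) M.Qt := by
    refine Integrable.of_bound
      (StronglyMeasurable.integral_kernel_prod_right' (κ := M.κ) hmeas).aestronglyMeasurable (m c)
      (ae_of_all _ fun θ => ?_)
    rw [Real.norm_of_nonneg (h0 θ)]
    exact hbd θ
  have hint : Integrable (fun q : 𝒳 × 𝒳 => dist q.1 q.2 ^ c) (M.Qt ⊗ₘ M.κ) := by
    rw [Measure.integrable_compProd_iff hmeas.aestronglyMeasurable]
    refine ⟨ae_of_all _ fun θ => ?_, ?_⟩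
    · simpa only [dist_comm] using M.cond_int θ c hc
    · simpa only [norm_pow, Real.norm_of_nonneg dist_nonneg] using hI
  refine ⟨hint, ?_⟩
  rw [Measure.integral_compProd hint]
  calc _ ≤ ∫ _, m c ∂M.Qt := integral_mono hI (integrable_const _) hbd
    _ = m c := by simp

theorem integral_dist_sq_compProd :
    ∫ q, dist q.1 q.2 ^ 2 ∂(M.Qt ⊗ₘ M.κ) = σsq := by
  rw [Measure.integral_compProd (M.integralLE_dist_pow_compProd (c := 2) (by norm_num)).1]
  have h : ∀ θ, ∫ u, dist θ u ^ 2 ∂(M.κ θ) = σsq := fun θ => by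
    simpa only [dist_comm] using M.cond_var θ
  simp [h]

theorem integralLE_dist_pow_fst {c : ℕ} (hc : 1 ≤ c) (z : 𝒳) :
    IntegralLE (M.Qt ⊗ₘ M.κ) (fun q => dist z q.1 ^ c)
      (2 ^ (c - 1) * (dist z M.μt ^ c + l c)) := by
  refine IntegralLE.comp (f := fun u => dist z u ^ c) ?_ M.measurePreserving_fst
  have hl : IntegralLE M.Qt (fun u => dist u M.μt ^ c) (l c) :=
    ⟨M.prior_int c hc, M.prior_bdd c hc⟩
  refine (((IntegralLE.const (dist z M.μt ^ c)).add hl).const_mul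
    (k := 2 ^ (c - 1)) (by positivity)).mono ?_ (fun u => by positivity) fun u => ?_
  · have : Measurable fun u : 𝒳 => dist z u ^ c := by fun_prop
    exact this.aestronglyMeasurable
  · refine le_trans ?_ (add_pow_le dist_nonneg dist_nonneg c)
    gcongr
    exact dist_triangle_right _ _ _

theorem integralLE_dist_pow_snd {c : ℕ} (z : 𝒳) {a b : ℝ}
    (ha : IntegralLE (M.Qt ⊗ₘ M.κ) (fun q => dist z q.1 ^ c) a)
    (hb : IntegralLE (M.Qt ⊗ₘ M.κ) (fun q => dist q.1 q.2 ^ c) b) :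
    IntegralLE (M.Qt ⊗ₘ M.κ) (fun q => dist z q.2 ^ c) (2 ^ (c - 1) * (a + b)) := by
  refine ((ha.add hb).const_mul (k := 2 ^ (c - 1)) (by positivity)).mono ?_
    (fun u => by positivity) fun u => ?_
  · have : Measurable fun q : 𝒳 × 𝒳 => dist z q.2 ^ c := by fun_prop
    exact this.aestronglyMeasurable
  · refine le_trans ?_ (add_pow_le dist_nonneg dist_nonneg c)
    gcongr
    exact dist_triangle _ _ _

theorem integrable_dist_sq_bind (z : 𝒳) :
    Integrable (fun u => dist z u ^ 2) (M.Qt.bind fun θ => M.κ θ) := by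
  rw [← M.measurePreserving_snd.map_eq, integrable_map_measure]
  · exact (M.integralLE_dist_pow_snd z (M.integralLE_dist_pow_fst one_le_two z)
      (M.integralLE_dist_pow_compProd one_le_two)).1
  · have : Measurable fun u : 𝒳 => dist z u ^ 2 := by fun_prop
    exact this.aestronglyMeasurable
  · exact measurable_snd.aemeasurable

theorem integral_dist_sq_bind (z : 𝒳) :
    ∫ u, dist z u ^ 2 ∂(M.Qt.bind fun θ => M.κ θ) = ∫ q, dist z q.2 ^ 2 ∂(M.Qt ⊗ₘ M.κ) := by
  rw [← M.measurePreserving_snd.map_eq, integral_map measurable_snd.aemeasurable]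
  have : Measurable fun u : 𝒳 => dist z u ^ 2 := by fun_prop
  exact this.aestronglyMeasurable

theorem add_integral_dist_sq_fst_le (G : GeodesicCAT0 𝒳) (z : 𝒳) :
    σsq + ∫ q, dist z q.1 ^ 2 ∂(M.Qt ⊗ₘ M.κ) ≤ ∫ q, dist z q.2 ^ 2 ∂(M.Qt ⊗ₘ M.κ) := by
  have h1 := (M.integralLE_dist_pow_fst one_le_two z).1
  have h2 := (M.integralLE_dist_pow_snd z (M.integralLE_dist_pow_fst one_le_two z)
      (M.integralLE_dist_pow_compProd one_le_two)).1
  have h3 : Integrable (fun θ => dist z θ ^ 2) M.Qt := by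
    rw [← M.measurePreserving_fst.map_eq, integrable_map_measure]
    · exact h1
    · have : Measurable fun u : 𝒳 => dist z u ^ 2 := by fun_prop
      exact this.aestronglyMeasurable
    · exact measurable_fst.aemeasurable
  rw [Measure.integral_compProd h1, Measure.integral_compProd h2]
  have h4 : ∀ θ, ∀ y, Integrable (fun u => dist y u ^ 2) (M.κ θ) := by
    intro θ y
    refine ((((integrable_const (dist y θ ^ 2)).add (M.cond_int θ 2 one_le_two)).const_mul 2)).mono'
      ?_ (ae_of_all _ fun u => ?_)
    · have : Measurable fun u : 𝒳 => dist y u ^ 2 := by fun_prop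
      exact this.aestronglyMeasurable
    · rw [Real.norm_of_nonneg (by positivity)]
      have := dist_triangle_right y u θ
      calc dist y u ^ 2 ≤ (dist y θ + dist u θ) ^ 2 := by gcongr
        _ ≤ 2 * (dist y θ ^ 2 + dist u θ ^ 2) := add_sq_le
  have h5 : ∀ θ, σsq + dist z θ ^ 2 ≤ ∫ u, dist z u ^ 2 ∂(M.κ θ) := by
    intro θ
    have := dist_sq_add_integral_le G (M.cond_mean θ) (h4 θ) z
    have hv : ∫ u, dist θ u ^ 2 ∂(M.κ θ) = σsq := by
      simpa only [dist_comm] using M.cond_var θ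
    rw [hv, dist_comm θ z] at this
    linarith
  have h6 : ∫ θ, (σsq + dist z θ ^ 2) ∂M.Qt ≤ ∫ θ, ∫ u, dist z u ^ 2 ∂(M.κ θ) ∂M.Qt :=
    integral_mono ((integrable_const _).add h3) (Integrable.integral_compProd (κ := Kernel.const Unit M.Qt)
      (η := Kernel.prodMkLeft Unit M.κ) (a := ()) h2) h5
  rw [integral_add (integrable_const _) h3] at h6
  simpa using h6

end IIDHierModel

section Averages

variable {X : Type*} [MetricSpace X] {n : ℕ}

theorem sum_dist_sq_le {s : ℝ} (hs : 0 < s) (hn : 1 ≤ n) (y ω : X) (x : Fin n → X) :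
    (1 / (n : ℝ)) * ∑ i, dist y (x i) ^ 2 ≤ (1 + s) * dist y ω ^ 2
      + ((1 / (n : ℝ)) * ∑ i, dist ω (x i) ^ 2 + (1 / (n : ℝ)) * (∑ i, dist ω (x i) ^ 2) / s) := by
  have hn' : (n : ℝ) ≠ 0 := by positivity
  have h : ∑ i, dist y (x i) ^ 2 ≤
      ∑ i, ((1 + s) * dist y ω ^ 2 + (dist ω (x i) ^ 2 + dist ω (x i) ^ 2 / s)) :=
    Finset.sum_le_sum fun i _ =>
      (pow_le_pow_left₀ dist_nonneg (dist_triangle y ω (x i)) 2).trans (add_sq_le_one_add_mul hs _ _)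
  rw [Finset.sum_add_distrib, Finset.sum_add_distrib, ← Finset.sum_div] at h
  simp only [Finset.sum_const, Finset.card_univ, Fintype.card_fin, nsmul_eq_mul] at h
  calc _ ≤ (1 / (n : ℝ)) * (n * ((1 + s) * dist y ω ^ 2)
        + (∑ i, dist ω (x i) ^ 2 + (∑ i, dist ω (x i) ^ 2) / s)) := by gcongr
    _ = _ := by field_simp

theorem GeodesicCAT0.sum_dist_sq_le (G : GeodesicCAT0 X) (y : X) (x θ : Fin n → X) {w : ℝ}
    (hw : w ∈ Set.Icc (0 : ℝ) 1) :
    (1 / (n : ℝ)) * ∑ i, dist (θ i) (G.γ (x i) y w) ^ 2 ≤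
      (1 - w) * ((1 / (n : ℝ)) * ∑ i, dist (θ i) (x i) ^ 2)
      + w * ((1 / (n : ℝ)) * ∑ i, dist y (θ i) ^ 2)
      - w * (1 - w) * ((1 / (n : ℝ)) * ∑ i, dist (x i) y ^ 2) := by
  have h : ∑ i, dist (θ i) (G.γ (x i) y w) ^ 2 ≤
      ∑ i, ((1 - w) * dist (θ i) (x i) ^ 2 + w * dist y (θ i) ^ 2
        - w * (1 - w) * dist (x i) y ^ 2) :=
    Finset.sum_le_sum fun i _ => by
      rw [dist_comm (θ i), dist_comm (θ i)]
      exact G.cat0 (x i) y (θ i) w hw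
  rw [Finset.sum_sub_distrib, Finset.sum_add_distrib, ← Finset.mul_sum, ← Finset.mul_sum,
    ← Finset.mul_sum] at h
  calc _ ≤ (1 / (n : ℝ)) * ((1 - w) * ∑ i, dist (θ i) (x i) ^ 2 + w * ∑ i, dist y (θ i) ^ 2
        - w * (1 - w) * ∑ i, dist (x i) y ^ 2) := by gcongr
    _ = _ := by ring

end Averages

namespace IIDHierModel

variable {𝒳 : Type*} [MetricSpace 𝒳] [MeasurableSpace 𝒳] {σsq : ℝ} {m l : ℕ → ℝ}
  [BorelSpace 𝒳] [SecondCountableTopology 𝒳] (M : IIDHierModel 𝒳 σsq m l)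

/-- Uniform moment bounds around the Fréchet mean of the marginal law. -/
theorem exists_isFrechetMean_moment_bounds [CompleteSpace 𝒳] (G : GeodesicCAT0 𝒳) {L : ℝ}
    (hL : L = 2 * (l 2 + σsq)) :
    ∃ ω, IsFrechetMean (M.Qt.bind fun θ => M.κ θ) ω ∧
      ∫ q, dist ω q.2 ^ 2 ∂(M.Qt ⊗ₘ M.κ) ≤ L ∧
      IntegralLE (M.Qt ⊗ₘ M.κ) (fun q => dist ω q.1 ^ 4) (8 * (L ^ 2 + l 4)) ∧
      IntegralLE (M.Qt ⊗ₘ M.κ) (fun q => dist ω q.2 ^ 4) (8 * (8 * (L ^ 2 + l 4) + m 4)) := by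
  have : Nonempty 𝒳 := ⟨M.μt⟩
  obtain ⟨ω, hω⟩ := exists_isFrechetMean G M.integrable_dist_sq_bind
  have hμ : ∫ q, dist M.μt q.2 ^ 2 ∂(M.Qt ⊗ₘ M.κ) ≤ L := by
    have h1 : IntegralLE (M.Qt ⊗ₘ M.κ) (fun q => dist M.μt q.1 ^ 2) (l 2) :=
      IntegralLE.comp (f := fun u => dist M.μt u ^ 2)
        ⟨by simpa only [dist_comm] using M.prior_int 2 one_le_two,
          by simpa only [dist_comm] using M.prior_bdd 2 one_le_two⟩ M.measurePreserving_fst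
    have h2 := (M.integralLE_dist_pow_snd M.μt h1
      ⟨(M.integralLE_dist_pow_compProd one_le_two).1, M.integral_dist_sq_compProd.le⟩).2
    rw [hL]
    simpa using h2
  have hd := dist_sq_add_integral_le G hω M.integrable_dist_sq_bind M.μt
  rw [M.integral_dist_sq_bind, M.integral_dist_sq_bind] at hd
  have h0 : 0 ≤ ∫ q, dist ω q.2 ^ 2 ∂(M.Qt ⊗ₘ M.κ) := integral_nonneg fun q => by positivity
  have hdist : dist ω M.μt ^ 2 ≤ L := by linarith
  have hfst : IntegralLE (M.Qt ⊗ₘ M.κ) (fun q => dist ω q.1 ^ 4) (8 * (L ^ 2 + l 4)) := by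
    refine (M.integralLE_dist_pow_fst (c := 4) (by norm_num) ω).weaken ?_
    have h4 : dist ω M.μt ^ 4 ≤ L ^ 2 := by
      calc dist ω M.μt ^ 4 = (dist ω M.μt ^ 2) ^ 2 := by ring
        _ ≤ L ^ 2 := by gcongr
    norm_num
    linarith
  refine ⟨ω, hω, by linarith [sq_nonneg (dist ω M.μt)], hfst, ?_⟩
  have h := M.integralLE_dist_pow_snd ω hfst (M.integralLE_dist_pow_compProd (c := 4) (by norm_num))
  norm_num at h
  exact h

end IIDHierModel

/-- The numerical estimate turning the expected loss bound into a strict improvement. -/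
theorem riskBound_lt {σsq s n L Δ β a b v c K : ℝ} (hσ : 0 < σsq) (hs : 1 ≤ s) (hsn : s ^ 2 = n)
    (hβ : 0 ≤ β) (hβΔ : σsq + β ≤ Δ) (hΔL : Δ ≤ L) (hv : 0 ≤ v) (hc : 0 ≤ c)
    (hK : K = a / 2 + 2 * (1 + L / σsq) * c + L + b / 2 + L * v / (2 * σsq) + L ^ 2 / σsq + 1
      + L / (2 * σsq))
    (hsK : K * L / σsq ^ 2 < s) :
    σsq + s / 2 * (a / n) + (1 + β / σsq) * (1 + s) * (c / n) + 1 / s * β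
      + s / 2 * (b / n) + β / σsq * (s / 2) * (v / n) + β / σsq * (1 / s) * Δ
      + (-σsq + 1 / s + β * (σsq / Δ) + β / σsq * (1 / (2 * s))) < σsq := by
  have hs0 : 0 < s := by linarith
  have hΔ0 : 0 < Δ := by linarith
  have hL0 : 0 < L := by linarith
  have hβL : β ≤ L := by linarith
  have h1 : β * (σsq / Δ) ≤ σsq - σsq ^ 2 / L := by
    have h2 : β * (σsq / Δ) ≤ (Δ - σsq) * (σsq / Δ) := by gcongr; linarith
    have h3 : (Δ - σsq) * (σsq / Δ) = σsq - σsq ^ 2 / Δ := by field_simp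
    have h4 : σsq ^ 2 / L ≤ σsq ^ 2 / Δ := by gcongr
    linarith
  have h2 : K / s < σsq ^ 2 / L := by
    rw [div_lt_div_iff₀ hs0 hL0]
    rw [div_lt_iff₀ (by positivity)] at hsK
    linarith
  have h3 : (1 + β / σsq) * (1 + s) * (c / n) ≤ 2 * (1 + L / σsq) * c / s := by
    calc (1 + β / σsq) * (1 + s) * (c / n) ≤ (1 + L / σsq) * (s + s) * (c / n) := by
          have : 0 ≤ n := by rw [← hsn]; positivity
          gcongr
      _ = _ := by rw [← hsn]; field_simp; ring
  have h4 : β / σsq * (s / 2) * (v / n) ≤ L * v / (2 * σsq) / s := by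
    calc β / σsq * (s / 2) * (v / n) ≤ L / σsq * (s / 2) * (v / n) := by
          have : 0 ≤ n := by rw [← hsn]; positivity
          gcongr
      _ = _ := by rw [← hsn]; field_simp
  have h5 : β / σsq * (1 / s) * Δ ≤ L ^ 2 / σsq / s := by
    calc β / σsq * (1 / s) * Δ ≤ L / σsq * (1 / s) * L := by gcongr
      _ = _ := by field_simp
  have h6 : β / σsq * (1 / (2 * s)) ≤ L / (2 * σsq) / s := by
    calc β / σsq * (1 / (2 * s)) ≤ L / σsq * (1 / (2 * s)) := by gcongr
      _ = _ := by field_simp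
  have h7 : 1 / s * β ≤ L / s := by
    calc 1 / s * β ≤ 1 / s * L := by gcongr
      _ = _ := by field_simp
  have h8 : ∀ y : ℝ, s / 2 * (y / n) = y / 2 / s := fun y => by rw [← hsn]; field_simp
  have h9 : K / s = a / 2 / s + 2 * (1 + L / σsq) * c / s + L / s + b / 2 / s
      + L * v / (2 * σsq) / s + L ^ 2 / σsq / s + 1 / s + L / (2 * σsq) / s := by
    rw [hK]; ring
  rw [h8, h8]
  linarith

/-- Bayes-risk domination for the adaptive geodesic James–Stein estimator
(Theorem 7).  If the sample Fréchet mean `X̄⁽ⁿ⁾` satisfies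
`E[d(X̄⁽ⁿ⁾(X),ω)²] ≤ C/n` uniformly over all i.i.d. hierarchical models (with `C`
depending only on `m`, `l`), then there is `n*` depending only on `σ², m, l` such that
for all `n ≥ n*` and all such models, shrinking towards `X̄⁽ⁿ⁾` strictly reduces the
Bayes risk: `E[d(θ,δ_JS(X))²] < E[d(θ,X)²] = σ²`. -/
theorem adaptive_geodesic_james_stein_bayes_dominates
    (σsq : ℝ) (hσ : 0 < σsq) (m l : ℕ → ℝ) (hm : ∀ c, 0 < m c) (hl : ∀ c, 0 < l c)
    {𝒳 : Type*} [MetricSpace 𝒳] [CompleteSpace 𝒳] [TopologicalSpace.SeparableSpace 𝒳]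
    [MeasurableSpace 𝒳] [BorelSpace 𝒳]
    (G : GeodesicCAT0 𝒳) (hG : G.MeasurableGeo)
    (Xbar : ∀ n : ℕ, (Fin n → 𝒳) → 𝒳)
    (hXbar_meas : ∀ n, Measurable (Xbar n))
    (hXbar_min : ∀ (n : ℕ) (x : Fin n → 𝒳) (z : 𝒳),
      ∑ i, dist (Xbar n x) (x i) ^ 2 ≤ ∑ i, dist z (x i) ^ 2)
    (C : ℝ)
    (hC : ∀ n : ℕ, 1 ≤ n → ∀ M : IIDHierModel 𝒳 σsq m l, ∀ ω : 𝒳,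
      IsFrechetMean (M.Qt.bind (fun θ => M.κ θ)) ω →
      ∫ p, dist (Xbar n p.2) ω ^ 2 ∂(M.joint n) ≤ C / n) :
    ∃ nstar : ℕ, ∀ n : ℕ, nstar ≤ n → ∀ M : IIDHierModel 𝒳 σsq m l,
      (∫ p, ((1 / (n : ℝ)) * ∑ i, dist (p.1 i)
            (G.γ (p.2 i) (Xbar n p.2)
              (jsWeight σsq ((1 / (n : ℝ)) * ∑ j, dist (p.2 j) (Xbar n p.2) ^ 2))) ^ 2)
          ∂(M.joint n)
        < ∫ p, ((1 / (n : ℝ)) * ∑ i, dist (p.1 i) (p.2 i) ^ 2) ∂(M.joint n)) ∧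
      ∫ p, ((1 / (n : ℝ)) * ∑ i, dist (p.1 i) (p.2 i) ^ 2) ∂(M.joint n) = σsq := by
  have : SecondCountableTopology 𝒳 := UniformSpace.secondCountable_of_separable 𝒳
  obtain ⟨L, hL⟩ : ∃ L, L = 2 * (l 2 + σsq) := ⟨_, rfl⟩
  obtain ⟨b, hb⟩ : ∃ b, b = 8 * (L ^ 2 + l 4) := ⟨_, rfl⟩
  obtain ⟨v, hv⟩ : ∃ v, v = 8 * (b + m 4) := ⟨_, rfl⟩
  obtain ⟨K, hK⟩ : ∃ K, K = m 4 / 2 + 2 * (1 + L / σsq) * |C| + L + b / 2 + L * v / (2 * σsq)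
    + L ^ 2 / σsq + 1 + L / (2 * σsq) := ⟨_, rfl⟩
  have hv0 : 0 ≤ v := by
    have := hl 4
    have := hm 4
    rw [hv, hb]; positivity
  refine ⟨⌈(K * L / σsq ^ 2) ^ 2⌉₊ + 1, fun n hn M => ?_⟩
  have hn1 : 1 ≤ n := by omega
  have hn0 : (0 : ℝ) < n := by positivity
  obtain ⟨hAm, hAv⟩ := M.memLp_sq_of_integralLE (f := fun q => dist q.1 q.2) (by fun_prop)
    (M.integralLE_dist_pow_compProd (c := 4) (by norm_num))
  obtain ⟨hA, hA2⟩ := M.empAvg_bounds hn1 hAm M.integral_dist_sq_compProd hAv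
  have hAeq : ∫ p, ((1 / (n : ℝ)) * ∑ i, dist (p.1 i) (p.2 i) ^ 2) ∂(M.joint n) = σsq := by
    have hT := M.measurePreserving_joint n
    have h1 := integral_empAvg hn1 (hAm.integrable (by norm_num))
    rw [← hT.map_eq, integral_map hT.aemeasurable, M.integral_dist_sq_compProd] at h1
    · exact h1
    · rw [hT.map_eq]
      exact (memLp_empAvg hAm).aestronglyMeasurable
  refine ⟨?_, hAeq⟩
  rw [hAeq]
  obtain ⟨ω, hω, hΔL, hω1, hω2⟩ := M.exists_isFrechetMean_moment_bounds G hL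
  rw [← hb] at hω1 hω2
  rw [← hv] at hω2
  obtain ⟨hBm, hBv⟩ := M.memLp_sq_of_integralLE (f := fun q => dist ω q.1) (by fun_prop) hω1
  obtain ⟨hDm, hDv⟩ := M.memLp_sq_of_integralLE (f := fun q => dist ω q.2) (by fun_prop) hω2
  have hβΔ := M.add_integral_dist_sq_fst_le G ω
  have hβ : 0 ≤ ∫ q, dist ω q.1 ^ 2 ∂(M.Qt ⊗ₘ M.κ) := integral_nonneg fun q => by positivity
  obtain ⟨hB, hB2⟩ := M.empAvg_bounds hn1 hBm rfl hBv
  obtain ⟨hD, hD2⟩ := M.empAvg_bounds hn1 hDm rfl hDv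
  set β := ∫ q, dist ω q.1 ^ 2 ∂(M.Qt ⊗ₘ M.κ)
  set Δ := ∫ q, dist ω q.2 ^ 2 ∂(M.Qt ⊗ₘ M.κ)
  have hmin : ∀ x : Fin n → 𝒳, (1 / (n : ℝ)) * ∑ i, dist (x i) (Xbar n x) ^ 2
      ≤ (1 / (n : ℝ)) * ∑ i, dist ω (x i) ^ 2 := fun x => by
    have := hXbar_min n x ω
    simp only [dist_comm (Xbar n x)] at this
    gcongr
  have hE : IntegralLE (M.joint n) (fun p => dist (Xbar n p.2) ω ^ 2) (|C| / n) := by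
    have h1 : IntegralLE (M.joint n) (fun p => dist (Xbar n p.2) ω ^ 2) (4 * Δ) := by
      refine (hD.const_mul (k := 4) (by norm_num)).mono ?_ (fun p => by positivity) fun p => ?_
      · have h2 : Measurable fun p : (Fin n → 𝒳) × (Fin n → 𝒳) => dist (Xbar n p.2) ω ^ 2 := by
          have := hXbar_meas n
          fun_prop
        exact h2.aestronglyMeasurable
      · have h2 : n * dist (Xbar n p.2) ω ^ 2 ≤
            ∑ i, 2 * (dist (p.2 i) (Xbar n p.2) ^ 2 + dist ω (p.2 i) ^ 2) := by
          calc (n : ℝ) * dist (Xbar n p.2) ω ^ 2 = ∑ _i : Fin n, dist (Xbar n p.2) ω ^ 2 := by simp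
            _ ≤ _ := Finset.sum_le_sum fun i _ => by
              refine le_trans ?_ add_sq_le
              rw [dist_comm (p.2 i), dist_comm ω]
              gcongr
              exact dist_triangle _ _ _
        rw [← Finset.mul_sum, Finset.sum_add_distrib] at h2
        have h3 := hmin p.2
        have h4 : dist (Xbar n p.2) ω ^ 2 ≤ 2 * ((1 / (n : ℝ)) * ∑ i, dist (p.2 i) (Xbar n p.2) ^ 2
            + (1 / (n : ℝ)) * ∑ i, dist ω (p.2 i) ^ 2) := by
          calc dist (Xbar n p.2) ω ^ 2 = (1 / (n : ℝ)) * (n * dist (Xbar n p.2) ω ^ 2) := by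
                field_simp
            _ ≤ (1 / (n : ℝ)) * (2 * (∑ i, dist (p.2 i) (Xbar n p.2) ^ 2
                + ∑ i, dist ω (p.2 i) ^ 2)) := by gcongr
            _ = _ := by ring
        linarith
    refine ⟨h1.1, (hC n hn1 M ω hω).trans ?_⟩
    gcongr
    exact le_abs_self C
  obtain ⟨s, hs⟩ : ∃ s, s = √(n : ℝ) := ⟨_, rfl⟩
  have hs1 : 1 ≤ s := by
    rw [hs, Real.one_le_sqrt]
    exact_mod_cast hn1
  have hs0 : 0 < s := by linarith
  have hsn : s ^ 2 = n := by rw [hs, Real.sq_sqrt hn0.le]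
  have hsK : K * L / σsq ^ 2 < s := by
    rw [hs]
    refine Real.lt_sqrt_of_sq_lt ((Nat.le_ceil _).trans_lt ?_)
    exact_mod_cast hn
  have hbound := ((((((hA.add (hA2.const_mul (k := s / 2) (by positivity))).add
    (hE.const_mul (k := (1 + β / σsq) * (1 + s)) (by positivity))).add
    (hB.const_mul (k := 1 / s) (by positivity))).add
    (hB2.const_mul (k := s / 2) (by positivity))).add
    (hD2.const_mul (k := β / σsq * (s / 2)) (by positivity))).add
    (hD.const_mul (k := β / σsq * (1 / s)) (by positivity))).add
    (IntegralLE.const (-σsq + 1 / s + β * (σsq / Δ) + β / σsq * (1 / (2 * s))))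
  refine lt_of_le_of_lt ?_ (hbound.2.trans_lt (riskBound_lt hσ hs1 hsn hβ hβΔ hΔL hv0
    (abs_nonneg C) hK hsK))
  refine integral_mono_of_nonneg (ae_of_all _ fun p => by positivity) hbound.1
    (ae_of_all _ fun p => ?_)
  have hD0 : 0 ≤ (1 / (n : ℝ)) * ∑ j, dist (p.2 j) (Xbar n p.2) ^ 2 := by positivity
  refine jamesStein_loss_le hσ hs0 (by linarith) hβ hD0 (by positivity) (by positivity)
    (by positivity) (sum_dist_sq_le hs0 hn1 (Xbar n p.2) ω p.1) ?_
    (G.sum_dist_sq_le (Xbar n p.2) p.2 p.1 (jsWeight_mem_Icc hσ hD0))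
  have h1 := sum_dist_sq_le hs0 hn1 ω (Xbar n p.2) p.2
  simp only [dist_comm (Xbar n p.2) (p.2 _)] at h1
  rw [dist_comm ω] at h1
  have h2 : (1 / (n : ℝ)) * (∑ j, dist (p.2 j) (Xbar n p.2) ^ 2) / s
      ≤ (1 / (n : ℝ)) * (∑ j, dist ω (p.2 j) ^ 2) / s := by
    gcongr ?_ / s
    exact hmin p.2
  linarith
end

section
/- Fix σ² > 0 and positive-real sequences m and l, and let (𝒳,d) be a separable complete metric space with a jointly Borel measurable geodesic CAT(0) structure. In the i.i.d. hierarchical model where θ₁,…,θₙ are i.i.d. with law Q̃ ∈ 𝒫_l⁽¹⁾ and, given θ, the Xᵢ are conditionally independent with Xᵢ | θᵢ ∼ P̃_{θᵢ} ∈ 𝒫_m⁽¹⁾ having Fréchet mean θᵢ and Fréchet variance σ², let ψ̃ ∈ 𝒳 be a fixed point and ψ⁽ⁿ⁾ = (ψ̃,…,ψ̃) the constant shrinkage point. Then the Bayes risk of the geodesic James–Stein estimator satisfies limsupₙ E[d(θ⁽ⁿ⁾,δ_JS(X⁽ⁿ⁾))²] ≤ σ²·E[d(θ₁,ψ̃)²]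 / (σ² + E[d(θ₁,ψ̃)²]), where all expectations are under the joint law of (θ⁽ⁿ⁾,X⁽ⁿ⁾). -/
open MeasureTheory ProbabilityTheory Filter

open scoped ProbabilityTheory

lemma jsWeight_nonneg {a s : ℝ} (ha : 0 ≤ a) (hs : 0 ≤ s) : 0 ≤ jsWeight a s := by
  unfold jsWeight
  split_ifs
  · exact zero_le_one
  · exact le_min zero_le_one (by positivity)

lemma jsWeight_le_one (a s : ℝ) : jsWeight a s ≤ 1 := by
  unfold jsWeight
  split_ifs
  · exact le_rfl
  · exact min_le_left _ _

lemma jsWeight_eq_one {a s : ℝ} (hs : 0 ≤ s) (hsa : s ≤ a) : jsWeight a s = 1 := by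
  unfold jsWeight
  split_ifs with h
  · rfl
  · exact min_eq_left ((one_le_div (lt_of_le_of_ne hs (Ne.symm h))).2 hsa)

lemma jsWeight_eq_div {a s : ℝ} (ha : 0 < a) (has : a ≤ s) : jsWeight a s = a / s := by
  have hs : 0 < s := ha.trans_le has
  rw [jsWeight, if_neg hs.ne', min_eq_right ((div_le_one hs).2 has)]

/-- The shrinkage weight is Lipschitz in the squared distance. -/
lemma jsWeight_le_div_add {a s S : ℝ} (ha : 0 < a) (hs : 0 ≤ s) (haS : a ≤ S) :
    jsWeight a s ≤ a / S + |s - S| / a := by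
  have hS : 0 < S := ha.trans_le haS
  rcases le_total s a with h | h
  · rw [jsWeight_eq_one hs h]
    have h1 : S - s ≤ |s - S| := by rw [abs_sub_comm]; exact le_abs_self _
    have h2 : (S - a) / a ≤ |s - S| / a := by gcongr; linarith
    refine le_trans ?_ (add_le_add_right h2 _)
    rw [div_add_div _ _ hS.ne' ha.ne', le_div_iff₀ (by positivity)]
    nlinarith [sq_nonneg (S - a)]
  · rw [jsWeight_eq_div ha h]
    have hs' : 0 < s := ha.trans_le h
    have h1 : S - s ≤ |s - S| := by rw [abs_sub_comm]; exact le_abs_self _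
    have h2 : a / s - a / S ≤ |s - S| / a := by
      rw [div_sub_div _ _ hs'.ne' hS.ne', div_le_div_iff₀ (by positivity) ha]
      have h3 : a * (S - s) * a ≤ a * |s - S| * a := by gcongr
      have h4 : a * a ≤ s * S := by gcongr
      nlinarith [mul_le_mul_of_nonneg_left h4 (abs_nonneg (s - S))]
    linarith

/-- Using the James–Stein weight, the CAT(0) upper bound on the loss simplifies. -/
lemma jsWeight_loss_eq {a s x y : ℝ} (ha : 0 < a) (hs : 0 ≤ s) :
    (1 - jsWeight a s) * x + jsWeight a s * y - jsWeight a s * (1 - jsWeight a s) * s =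
      (1 - jsWeight a s) * (x - a) + jsWeight a s * y := by
  rcases le_total s a with h | h
  · rw [jsWeight_eq_one hs h]; ring
  · have hs' : s ≠ 0 := (ha.trans_le h).ne'
    rw [jsWeight_eq_div ha h]; field_simp; ring

lemma jsWeight_loss_le {a s x y A S : ℝ} (ha : 0 < a) (hs : 0 ≤ s) (hA : 0 ≤ A)
    (hS : a + A ≤ S) :
    (1 - jsWeight a s) * x + jsWeight a s * y - jsWeight a s * (1 - jsWeight a s) * s ≤
      a * A / (a + A) + |x - a| + |y - A| + A / a * |s - S| := by
  rw [jsWeight_loss_eq ha hs]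
  have h0 := jsWeight_nonneg ha.le hs
  have h1 := jsWeight_le_one a s
  have h2 := jsWeight_le_div_add ha hs (S := S) (by linarith)
  have h3 : a / S ≤ a / (a + A) := by gcongr
  have h4 : (1 - jsWeight a s) * (x - a) ≤ |x - a| :=
    (mul_le_mul_of_nonneg_left (le_abs_self _) (by linarith)).trans
      (mul_le_of_le_one_left (abs_nonneg _) (by linarith))
  have h5 : jsWeight a s * (y - A) ≤ |y - A| :=
    (mul_le_mul_of_nonneg_left (le_abs_self _) h0).trans
      (mul_le_of_le_one_left (abs_nonneg _) h1)
  have h6 : jsWeight a s * A ≤ (a / (a + A) + |s - S| / a) * A := by gcongr; linarith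
  have h7 : (a / (a + A) + |s - S| / a) * A = a * A / (a + A) + A / a * |s - S| := by ring
  linarith

lemma GeodesicCAT0.avg_dist_sq_le {X : Type*} [MetricSpace X] (G : GeodesicCAT0 X) {n : ℕ}
    (θ x : Fin n → X) (ψ : X) {w : ℝ} (hw : w ∈ Set.Icc (0 : ℝ) 1) :
    (1 / (n : ℝ)) * ∑ i, dist (θ i) (G.γ (x i) ψ w) ^ 2 ≤
      (1 - w) * ((1 / (n : ℝ)) * ∑ i, dist (x i) (θ i) ^ 2) +
        w * ((1 / (n : ℝ)) * ∑ i, dist (θ i) ψ ^ 2) -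
        w * (1 - w) * ((1 / (n : ℝ)) * ∑ i, dist (x i) ψ ^ 2) := by
  have h : ∑ i, dist (θ i) (G.γ (x i) ψ w) ^ 2 ≤
      ∑ i, ((1 - w) * dist (x i) (θ i) ^ 2 + w * dist (θ i) ψ ^ 2 -
        w * (1 - w) * dist (x i) ψ ^ 2) := by
    refine Finset.sum_le_sum fun i _ => ?_
    rw [dist_comm (θ i) (G.γ _ _ _), dist_comm (θ i) ψ]
    exact G.cat0 (x i) ψ (θ i) w hw
  refine (mul_le_mul_of_nonneg_left h (by positivity)).trans_eq ?_
  rw [Finset.sum_sub_distrib, Finset.sum_add_distrib, ← Finset.mul_sum, ← Finset.mul_sum,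
    ← Finset.mul_sum]
  ring

/-- The variance inequality for Fréchet means in CAT(0) spaces. -/
lemma GeodesicCAT0.variance_inequality {X : Type*} [MetricSpace X] [MeasurableSpace X]
    (G : GeodesicCAT0 X) {P : Measure X} [IsProbabilityMeasure P] {θ : X}
    (hθ : IsFrechetMean P θ) (z : X) (hint_θ : Integrable (fun u => dist u θ ^ 2) P)
    (hint_z : Integrable (fun u => dist u z ^ 2) P) :
    ∫ u, dist u θ ^ 2 ∂P + dist θ z ^ 2 ≤ ∫ u, dist u z ^ 2 ∂P := by
  simp_rw [dist_comm _ θ] at hint_θ ⊢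
  simp_rw [dist_comm _ z] at hint_z ⊢
  have key : ∀ t ∈ Set.Ioo (0 : ℝ) 1,
      ∫ u, dist θ u ^ 2 ∂P + (1 - t) * dist z θ ^ 2 ≤ ∫ u, dist z u ^ 2 ∂P := by
    intro t ht
    have h1 : ∫ u, dist θ u ^ 2 ∂P ≤
        ∫ u, ((1 - t) * dist θ u ^ 2 + t * dist z u ^ 2 - t * (1 - t) * dist θ z ^ 2) ∂P := by
      refine (hθ (G.γ θ z t)).trans ?_
      refine integral_mono_of_nonneg (ae_of_all _ fun u => by positivity) ?_
        (ae_of_all _ fun u => G.cat0 θ z u t ⟨ht.1.le, ht.2.le⟩)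
      exact ((hint_θ.const_mul _).add (hint_z.const_mul _)).sub (integrable_const _)
    have h2 : Integrable (fun u => (1 - t) * dist θ u ^ 2 + t * dist z u ^ 2) P :=
      (hint_θ.const_mul _).add (hint_z.const_mul _)
    rw [integral_sub h2 (integrable_const _), integral_add (hint_θ.const_mul _)
      (hint_z.const_mul _), integral_const_mul, integral_const_mul, integral_const,
      dist_comm θ z] at h1
    simp only [probReal_univ, smul_eq_mul, one_mul] at h1
    refine le_of_mul_le_mul_left ?_ ht.1
    linarith
  have hlim : Tendsto (fun t : ℝ => ∫ u, dist θ u ^ 2 ∂P + (1 - t) * dist z θ ^ 2)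
      (nhdsWithin 0 (Set.Ioi 0)) (nhds (∫ u, dist θ u ^ 2 ∂P + (1 - 0) * dist z θ ^ 2)) :=
    (Continuous.tendsto (by fun_prop) 0).mono_left nhdsWithin_le_nhds
  have := le_of_tendsto hlim (by
    filter_upwards [Ioo_mem_nhdsGT (zero_lt_one (α := ℝ))] with t ht using key t ht)
  simpa using this

section Averages

variable {E : Type*} [MeasurableSpace E] {ν : Measure E} [IsProbabilityMeasure ν] {f : E → ℝ}

lemma memLp_avg (hf : MemLp f 2 ν) (n : ℕ) :
    MemLp (fun ω : Fin n → E => (1 / (n : ℝ)) * ∑ i, f (ω i)) 2 (Measure.pi fun _ => ν) := by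
  have hi (i : Fin n) : MemLp (fun ω : Fin n → E => f (ω i)) 2 (Measure.pi fun _ => ν) :=
    hf.comp_measurePreserving (measurePreserving_eval (fun _ : Fin n => ν) i)
  exact (memLp_finsetSum _ fun i _ => hi i).const_mul _

lemma memLp_avg_sub_integral (hf : MemLp f 2 ν) (n : ℕ) :
    MemLp (fun ω : Fin n → E => (1 / (n : ℝ)) * ∑ i, f (ω i) - ∫ x, f x ∂ν) 2
      (Measure.pi fun _ => ν) :=
  (memLp_avg hf n).sub (memLp_const _)

lemma integral_avg (hf : MemLp f 2 ν) {n : ℕ} (hn : n ≠ 0) :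
    ∫ ω : Fin n → E, (1 / (n : ℝ)) * ∑ i, f (ω i) ∂(Measure.pi fun _ => ν) = ∫ x, f x ∂ν := by
  have hi (i : Fin n) : Integrable (fun ω : Fin n → E => f (ω i)) (Measure.pi fun _ => ν) :=
    (hf.comp_measurePreserving (measurePreserving_eval (fun _ : Fin n => ν) i)).integrable
      one_le_two
  have he (i : Fin n) :
      ∫ ω : Fin n → E, f (ω i) ∂(Measure.pi fun _ => ν) = ∫ x, f x ∂ν := by
    have h := measurePreserving_eval (fun _ : Fin n => ν) i
    conv_rhs => rw [← h.map_eq]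
    rw [integral_map h.measurable.aemeasurable (h.map_eq.symm ▸ hf.aestronglyMeasurable)]
  rw [integral_const_mul, integral_finsetSum _ fun i _ => hi i]
  simp only [he, Finset.sum_const, Finset.card_univ, Fintype.card_fin, nsmul_eq_mul]
  field_simp

/-- A quantitative `L¹` law of large numbers for square integrable functions. -/
lemma integral_abs_avg_sub_le (hf : MemLp f 2 ν) {n : ℕ} (hn : n ≠ 0) :
    ∫ ω : Fin n → E, |(1 / (n : ℝ)) * ∑ i, f (ω i) - ∫ x, f x ∂ν| ∂(Measure.pi fun _ => ν) ≤
      √(Var[f; ν] / n) := by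
  have hg := memLp_avg_sub_integral hf n
  refine Real.le_sqrt_of_sq_le ?_
  have hsq : ∫ ω : Fin n → E, ((1 / (n : ℝ)) * ∑ i, f (ω i) - ∫ x, f x ∂ν) ^ 2
      ∂(Measure.pi fun _ => ν) = Var[f; ν] / n := by
    have h1 := variance_eq_integral (memLp_avg hf n).aestronglyMeasurable.aemeasurable
    rw [integral_avg hf hn] at h1
    rw [← h1, variance_const_mul]
    have h2 := variance_sum_pi (μ := fun _ : Fin n => ν) (X := fun _ => f) fun _ => hf
    rw [show (fun ω : Fin n → E => ∑ i, f (ω i)) = ∑ i, fun ω : Fin n → E => f (ω i) by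
      ext ω; simp, h2]
    simp only [Finset.sum_const, Finset.card_univ, Fintype.card_fin, nsmul_eq_mul]
    field_simp
  have hv := variance_nonneg
    (fun ω : Fin n → E => |(1 / (n : ℝ)) * ∑ i, f (ω i) - ∫ x, f x ∂ν|) (Measure.pi fun _ => ν)
  have habs : MemLp (fun ω : Fin n → E => |(1 / (n : ℝ)) * ∑ i, f (ω i) - ∫ x, f x ∂ν|) 2
      (Measure.pi fun _ => ν) := hg.abs
  rw [variance_eq_sub habs] at hv
  simp only [Pi.pow_apply, sq_abs] at hv
  linarith

end Averages

lemma dist_pow_four_le {X : Type*} [MetricSpace X] (x y z : X) : dist x z ^ 4 ≤ 8 * (dist x y ^ 4 + dist y z ^ 4) := by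
  have h1 : dist x z ^ 4 ≤ (dist x y + dist y z) ^ 4 := by
    gcongr; exact dist_triangle _ _ _
  have h2 := add_pow_le (dist_nonneg (x := x) (y := y)) (dist_nonneg (x := y) (y := z)) 4
  norm_num at h2
  linarith

namespace IIDHierModel

variable {𝒳 : Type*} [MetricSpace 𝒳] [MeasurableSpace 𝒳] {σsq : ℝ} {m l : ℕ → ℝ}

/-- The coordinate pairs `(θᵢ, Xᵢ)` are i.i.d. under the joint law. -/
lemma measurePreserving_zip (M : IIDHierModel 𝒳 σsq m l) (n : ℕ) :
    MeasurePreserving (fun (p : (Fin n → 𝒳) × (Fin n → 𝒳)) i => (p.1 i, p.2 i)) (M.joint n)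
      (Measure.pi fun _ => M.Qt ⊗ₘ M.κ) := by
  have hmeas : Measurable fun (p : (Fin n → 𝒳) × (Fin n → 𝒳)) i => (p.1 i, p.2 i) := by
    fun_prop
  refine ⟨hmeas, (Measure.pi_eq fun s hs => ?_).symm⟩
  have hpi : MeasurableSet (Set.univ.pi s) := MeasurableSet.univ_pi hs
  rw [Measure.map_apply hmeas hpi, joint, Measure.compProd_apply (hmeas hpi)]
  have hsec (θ : Fin n → 𝒳) : M.κn n θ (Prod.mk θ ⁻¹'
      ((fun (p : (Fin n → 𝒳) × (Fin n → 𝒳)) i => (p.1 i, p.2 i)) ⁻¹' Set.univ.pi s)) =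
      ∏ i, M.κ (θ i) (Prod.mk (θ i) ⁻¹' s i) := by
    rw [M.κn_pi, ← Measure.pi_pi]
    congr 1
  have hk (i : Fin n) : Measurable fun x => M.κ x (Prod.mk x ⁻¹' s i) :=
    Kernel.measurable_kernel_prodMk_left (hs i)
  simp_rw [hsec]
  rw [lintegral_prod_eq_prod_lintegral_of_indepFun Finset.univ
    (fun i (θ : Fin n → 𝒳) => M.κ (θ i) (Prod.mk (θ i) ⁻¹' s i))
    (iIndepFun_pi (μ := fun _ : Fin n => M.Qt) fun i => (hk i).aemeasurable)
    (fun i => (hk i).comp (measurable_pi_apply i))]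
  refine Finset.prod_congr rfl fun i _ => ?_
  rw [Measure.compProd_apply (hs i)]
  exact (measurePreserving_eval (fun _ : Fin n => M.Qt) i).lintegral_comp (hk i)

section Moments

variable [TopologicalSpace.SeparableSpace 𝒳] [BorelSpace 𝒳]

lemma memLp_dist_sq {Ω : Type*} [MeasurableSpace Ω] {P : Measure Ω} {f g : Ω → 𝒳}
    (hf : Measurable f) (hg : Measurable g)
    (h : Integrable (fun ω => dist (f ω) (g ω) ^ 4) P) :
    MemLp (fun ω => dist (f ω) (g ω) ^ 2) 2 P := by
  have := UniformSpace.secondCountable_of_separable 𝒳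
  rw [memLp_two_iff_integrable_sq (by fun_prop)]
  simpa only [← pow_mul] using h

lemma integrable_dist_pow_four_trans {Ω : Type*} [MeasurableSpace Ω] {P : Measure Ω}
    {f g h : Ω → 𝒳} (hf : Measurable f) (hh : Measurable h)
    (hfg : Integrable (fun ω => dist (f ω) (g ω) ^ 4) P)
    (hgh : Integrable (fun ω => dist (g ω) (h ω) ^ 4) P) :
    Integrable (fun ω => dist (f ω) (h ω) ^ 4) P := by
  have := UniformSpace.secondCountable_of_separable 𝒳
  refine ((hfg.add hgh).const_mul 8).mono' (by fun_prop) (ae_of_all _ fun ω => ?_)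
  rw [Real.norm_of_nonneg (by positivity)]
  exact dist_pow_four_le _ _ _

lemma integrable_noise_pow_four (M : IIDHierModel 𝒳 σsq m l) :
    Integrable (fun p : 𝒳 × 𝒳 => dist p.2 p.1 ^ 4) (M.Qt ⊗ₘ M.κ) := by
  have := UniformSpace.secondCountable_of_separable 𝒳
  have hmeas : Measurable fun p : 𝒳 × 𝒳 => dist p.2 p.1 ^ 4 := by fun_prop
  rw [Measure.integrable_compProd_iff hmeas.aestronglyMeasurable]
  refine ⟨ae_of_all _ fun θ => M.cond_int θ 4 (by norm_num), ?_⟩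
  refine (integrable_const (m 4)).mono'
    (hmeas.norm.stronglyMeasurable.integral_kernel_prod_right').aestronglyMeasurable
    (ae_of_all _ fun θ => ?_)
  rw [Real.norm_of_nonneg (integral_nonneg fun _ => norm_nonneg _)]
  simpa using M.cond_bdd θ 4 (by norm_num)

lemma integrable_prior_pow_four (M : IIDHierModel 𝒳 σsq m l) (ψ : 𝒳) :
    Integrable (fun p : 𝒳 × 𝒳 => dist p.1 ψ ^ 4) (M.Qt ⊗ₘ M.κ) := by
  refine integrable_dist_pow_four_trans (g := fun _ => M.μt) measurable_fst measurable_const ?_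
    (integrable_const _)
  have h : MeasurePreserving Prod.fst (M.Qt ⊗ₘ M.κ) M.Qt :=
    ⟨measurable_fst, Measure.fst_compProd _ _⟩
  exact h.integrable_comp_of_integrable (M.prior_int 4 (by norm_num))

lemma memLp_noise (M : IIDHierModel 𝒳 σsq m l) :
    MemLp (fun p : 𝒳 × 𝒳 => dist p.2 p.1 ^ 2) 2 (M.Qt ⊗ₘ M.κ) :=
  memLp_dist_sq measurable_snd measurable_fst M.integrable_noise_pow_four

lemma memLp_prior (M : IIDHierModel 𝒳 σsq m l) (ψ : 𝒳) :
    MemLp (fun p : 𝒳 × 𝒳 => dist p.1 ψ ^ 2) 2 (M.Qt ⊗ₘ M.κ) :=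
  memLp_dist_sq measurable_fst measurable_const (M.integrable_prior_pow_four ψ)

lemma memLp_data (M : IIDHierModel 𝒳 σsq m l) (ψ : 𝒳) :
    MemLp (fun p : 𝒳 × 𝒳 => dist p.2 ψ ^ 2) 2 (M.Qt ⊗ₘ M.κ) :=
  memLp_dist_sq measurable_snd measurable_const
    (integrable_dist_pow_four_trans measurable_snd measurable_const
      M.integrable_noise_pow_four (M.integrable_prior_pow_four ψ))

lemma integral_noise (M : IIDHierModel 𝒳 σsq m l) :
    ∫ p, dist p.2 p.1 ^ 2 ∂(M.Qt ⊗ₘ M.κ) = σsq := by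
  rw [Measure.integral_compProd (M.memLp_noise.integrable one_le_two)]
  simp [M.cond_var]

lemma integral_prior (M : IIDHierModel 𝒳 σsq m l) (ψ : 𝒳) :
    ∫ p, dist p.1 ψ ^ 2 ∂(M.Qt ⊗ₘ M.κ) = ∫ θ, dist θ ψ ^ 2 ∂M.Qt := by
  rw [Measure.integral_compProd ((M.memLp_prior ψ).integrable one_le_two)]
  simp

lemma variance_add_le_integral_data (G : GeodesicCAT0 𝒳) (M : IIDHierModel 𝒳 σsq m l) (ψ : 𝒳) :
    σsq + ∫ θ, dist θ ψ ^ 2 ∂M.Qt ≤ ∫ p, dist p.2 ψ ^ 2 ∂(M.Qt ⊗ₘ M.κ) := by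
  have hd := (M.memLp_data ψ).integrable one_le_two
  have hp := (M.memLp_prior ψ).integrable one_le_two
  have hp' : Integrable (fun θ => dist θ ψ ^ 2) M.Qt := by
    simpa using hp.integral_compProd
  have hadd : ∫ θ, (σsq + dist θ ψ ^ 2) ∂M.Qt = σsq + ∫ θ, dist θ ψ ^ 2 ∂M.Qt := by
    rw [integral_add (integrable_const _) hp']
    simp
  rw [← hadd, Measure.integral_compProd hd]
  refine integral_mono_ae ((integrable_const _).add hp') hd.integral_compProd ?_
  filter_upwards [((Measure.integrable_compProd_iff hd.aestronglyMeasurable).1 hd).1] with θ hθ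
  simpa only [M.cond_var] using
    G.variance_inequality (M.cond_mean θ) ψ (M.cond_int θ 2 one_le_two) hθ

end Moments

lemma integrable_abs_avg_sub (M : IIDHierModel 𝒳 σsq m l) {f : 𝒳 × 𝒳 → ℝ}
    (hf : MemLp f 2 (M.Qt ⊗ₘ M.κ)) (n : ℕ) :
    Integrable (fun p : (Fin n → 𝒳) × (Fin n → 𝒳) =>
      |(1 / (n : ℝ)) * ∑ i, f (p.1 i, p.2 i) - ∫ q, f q ∂(M.Qt ⊗ₘ M.κ)|) (M.joint n) :=
  (M.measurePreserving_zip n).integrable_comp_of_integrable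
    ((memLp_avg_sub_integral hf n).integrable one_le_two).abs

lemma tendsto_integral_abs_avg_sub (M : IIDHierModel 𝒳 σsq m l) {f : 𝒳 × 𝒳 → ℝ}
    (hf : MemLp f 2 (M.Qt ⊗ₘ M.κ)) :
    Tendsto (fun n : ℕ => ∫ p : (Fin n → 𝒳) × (Fin n → 𝒳),
      |(1 / (n : ℝ)) * ∑ i, f (p.1 i, p.2 i) - ∫ q, f q ∂(M.Qt ⊗ₘ M.κ)| ∂(M.joint n))
      atTop (nhds 0) := by
  have hlim : Tendsto (fun n : ℕ => √(Var[f; M.Qt ⊗ₘ M.κ] / n)) atTop (nhds 0) := by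
    simpa using (tendsto_const_div_atTop_nhds_zero_nat Var[f; M.Qt ⊗ₘ M.κ]).sqrt
  refine squeeze_zero' (Eventually.of_forall fun n => integral_nonneg fun p => abs_nonneg _)
    ?_ hlim
  filter_upwards [eventually_ne_atTop 0] with n hn
  refine le_trans (le_of_eq ?_) (integral_abs_avg_sub_le hf hn)
  have hz := M.measurePreserving_zip n
  rw [← hz.map_eq, integral_map hz.measurable.aemeasurable]
  rw [hz.map_eq]
  exact (memLp_avg_sub_integral hf n).abs.aestronglyMeasurable

end IIDHierModel

/-- asymptotic Bayes risk bound for a constant shrinkage point `ψ̃` in the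
i.i.d. hierarchical model:
`limsupₙ E[d(θ⁽ⁿ⁾,δ_JS(X⁽ⁿ⁾))²] ≤ σ²·E[d(θ₁,ψ̃)²]/(σ² + E[d(θ₁,ψ̃)²])`. -/
theorem geodesic_james_stein_bayes_limsup_bound
    (σsq : ℝ) (hσ : 0 < σsq) (m l : ℕ → ℝ) (hm : ∀ c, 0 < m c) (hl : ∀ c, 0 < l c)
    {𝒳 : Type*} [MetricSpace 𝒳] [CompleteSpace 𝒳] [TopologicalSpace.SeparableSpace 𝒳]
    [MeasurableSpace 𝒳] [BorelSpace 𝒳]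
    (G : GeodesicCAT0 𝒳) (hG : G.MeasurableGeo)
    (M : IIDHierModel 𝒳 σsq m l)
    (ψt : 𝒳) :
    limsup (fun n : ℕ =>
      ∫ p, ((1 / (n : ℝ)) * ∑ i, dist (p.1 i)
          (G.γ (p.2 i) ψt
            (jsWeight σsq ((1 / (n : ℝ)) * ∑ j, dist (p.2 j) ψt ^ 2))) ^ 2)
        ∂(M.joint n)) atTop
      ≤ σsq * (∫ θ, dist θ ψt ^ 2 ∂M.Qt) / (σsq + ∫ θ, dist θ ψt ^ 2 ∂M.Qt) := by
  set A := ∫ θ, dist θ ψt ^ 2 ∂M.Qt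
  have hA : 0 ≤ A := integral_nonneg fun _ => by positivity
  have hS := M.variance_add_le_integral_data G ψt
  have hx := M.tendsto_integral_abs_avg_sub M.memLp_noise
  have hy := M.tendsto_integral_abs_avg_sub (M.memLp_prior ψt)
  have hs := M.tendsto_integral_abs_avg_sub (M.memLp_data ψt)
  have ix := M.integrable_abs_avg_sub M.memLp_noise
  have iy := M.integrable_abs_avg_sub (M.memLp_prior ψt)
  have iS := M.integrable_abs_avg_sub (M.memLp_data ψt)
  rw [M.integral_noise] at hx ix
  rw [M.integral_prior] at hy iy
  set S := ∫ p, dist p.2 ψt ^ 2 ∂(M.Qt ⊗ₘ M.κ)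
  have hlim := ((hx.const_add (σsq * A / (σsq + A))).add hy).add (hs.const_mul (A / σsq))
  rw [mul_zero, add_zero, add_zero, add_zero] at hlim
  rw [← hlim.limsup_eq]
  refine limsup_le_limsup (Eventually.of_forall fun n => ?_) ?_ hlim.isBoundedUnder_le
  · have : IsProbabilityMeasure (M.joint n) := by
      unfold IIDHierModel.joint; infer_instance
    have hbound := ((((integrable_const (σsq * A / (σsq + A))).add (ix n)).add (iy n)).add
      ((iS n).const_mul (A / σsq)))
    refine (integral_mono_of_nonneg (ae_of_all _ fun p => by positivity) hbound
      (ae_of_all _ fun p => ?_)).trans_eq ?_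
    · have hs0 : 0 ≤ (1 / (n : ℝ)) * ∑ j, dist (p.2 j) ψt ^ 2 := by positivity
      exact (G.avg_dist_sq_le p.1 p.2 ψt
        ⟨jsWeight_nonneg hσ.le hs0, jsWeight_le_one _ _⟩).trans
          (jsWeight_loss_le hσ hs0 hA hS)
    · rw [integral_add' (((integrable_const _).add (ix n)).add (iy n)) ((iS n).const_mul _),
        integral_add' ((integrable_const _).add (ix n)) (iy n),
        integral_add' (integrable_const _) (ix n), integral_const_mul]
      simp
  · exact isCoboundedUnder_le_of_le atTop (x := 0) fun n =>
      integral_nonneg fun p => by positivity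
end
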